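/- arXiv:1806.03998 — 3 statements merged into one kernel-verified Lean document; each statement's English description precedes it below -/
import Mathlib

section
/- The sum ∑_{n=0}^∞ C(2n,n) / ((2n+1)² · 8^n) equals √2 · (π·log 2 / 8 + G/2), where G is Catalan's constant. -/
open Real MeasureTheory Set

lemma aux_choose (n : ℕ) : Ring.choose ((1/2:ℝ) + n - 1) n = ((2 * n).choose n : ℝ) / 4 ^ n := by
  have h0 : Ring.choose ((1/2:ℝ) + n - 1) n = Ring.multichoose (1/2:ℝ) n := by
    rw [Ring.choose]; congr 1; ring
  have h1 := Ring.factorial_nsmul_multichoose_eq_ascPochhammer (1/2:ℝ) n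
  rw [h0]
  have h2 : (Nat.factorial n : ℝ) * (((2 * n).choose n : ℝ) / 4 ^ n)
      = (ascPochhammer ℝ n).eval (1/2) := by
    clear h0 h1
    induction n with
    | zero => simp
    | succ k ih =>
      rw [ascPochhammer_succ_eval, ← ih]
      have h := Nat.succ_mul_centralBinom_succ k
      rw [Nat.centralBinom_eq_two_mul_choose, Nat.centralBinom_eq_two_mul_choose] at h
      have h' : ((k:ℝ) + 1) * ((2 * (k+1)).choose (k+1) : ℝ)
        = 2 * (2 * k + 1) * ((2*k).choose k : ℝ) := by exact_mod_cast h
      rw [Nat.factorial_succ]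
      push_cast
      generalize ((2 * (k+1)).choose (k+1) : ℝ) = u at h' ⊢
      generalize ((2*k).choose k : ℝ) = v at h' ⊢
      have h4 : (4:ℝ) ^ k ≠ 0 := by positivity
      rw [pow_succ]
      field_simp
      linear_combination 2 * h'
  have h3 : (ascPochhammer ℕ n).smeval (1/2:ℝ) = (ascPochhammer ℝ n).eval (1/2) := by
    rw [Polynomial.ascPochhammer_smeval_eq_eval]
  rw [h3, ← h2, nsmul_eq_mul] at h1
  exact mul_left_cancel₀ (by positivity) h1

lemma aux_gen {x : ℝ} (h0 : 0 ≤ x) (h1 : x < 1) :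
    HasSum (fun n : ℕ => ((2 * n).choose n : ℝ) / 4 ^ n * x ^ n) (1 / √(1 - x)) := by
  have h := (Real.one_div_one_sub_rpow_hasFPowerSeriesOnBall_zero (1/2)).hasSum (y := x)
    (by simp [abs_of_nonneg h0, h1, enorm_eq_nnnorm, ← NNReal.coe_lt_coe])
  simp only [FormalMultilinearSeries.ofScalars_apply_eq, aux_choose, zero_add, smul_eq_mul,
    ← Real.sqrt_eq_rpow] at h
  exact h

lemma aux_int (φ φ' : ℝ → ℝ) (b : ℝ) (hb : 0 < b) (hc : ContinuousOn φ (Icc 0 b))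
    (hd : ∀ x ∈ Ioo 0 b, HasDerivAt φ (φ' x) x) (h0 : φ 0 = 0) (h1 : φ b = 1)
    (hp : ∀ x ∈ Ioo 0 b, 0 < φ x ∧ φ x < 1 ∧ 0 ≤ φ' x) (n : ℕ) :
    IntervalIntegrable (fun x => φ x ^ (2 * n) * φ' x * -log (φ x)) volume 0 b ∧
    ∫ x in (0:ℝ)..b, φ x ^ (2 * n) * φ' x * -log (φ x) = 1 / (2 * n + 1) ^ 2 := by
  set g : ℝ → ℝ := fun x => -(φ x ^ (2 * n) * (φ x * log (φ x)) / (2 * n + 1))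
    + φ x ^ (2 * n + 1) / (2 * n + 1) ^ 2 with hg
  have hgc : ContinuousOn g (Icc 0 b) := by
    have : ContinuousOn (fun x => φ x * log (φ x)) (Icc 0 b) :=
      Real.continuous_mul_log.comp_continuousOn hc
    fun_prop
  have hgd : ∀ x ∈ Ioo 0 b, HasDerivAt g (φ x ^ (2 * n) * φ' x * -log (φ x)) x := by
    intro x hx
    have hpx := (hp x hx).1
    have hl := (hd x hx).log hpx.ne'
    have hG : HasDerivAt (fun x => -(φ x ^ (2 * n + 1) * log (φ x) / (2 * n + 1))
      + φ x ^ (2 * n + 1) / (2 * n + 1) ^ 2) (φ x ^ (2 * n) * φ' x * -log (φ x)) x := by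
      have := (((((hd x hx).pow (2 * n + 1)).mul hl).div_const (2 * (n:ℝ) + 1)).neg).add
        (((hd x hx).pow (2 * n + 1)).div_const ((2 * (n:ℝ) + 1)^2))
      refine HasDerivAt.congr_deriv this ?_
      simp only [Nat.add_sub_cancel, Pi.pow_apply]
      push_cast
      have : (2 * (n:ℝ) + 1) ≠ 0 := by positivity
      field_simp
      ring
    convert hG using 1
    ext y
    simp only [hg]; ring
  have hint : IntervalIntegrable (fun x => φ x ^ (2 * n) * φ' x * -log (φ x)) volume 0 b := by
    apply intervalIntegral.intervalIntegrable_deriv_of_nonneg (g := g)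
    · rwa [uIcc_of_le hb.le]
    · rwa [min_eq_left hb.le, max_eq_right hb.le]
    · rw [min_eq_left hb.le, max_eq_right hb.le]
      intro x hx
      obtain ⟨a1, a2, a3⟩ := hp x hx
      have := Real.log_neg a1 a2
      have : 0 ≤ -log (φ x) := by linarith
      positivity
  refine ⟨hint, ?_⟩
  rw [intervalIntegral.integral_eq_sub_of_hasDerivAt_of_le hb.le hgc hgd hint]
  simp [hg, h0, h1]

lemma aux_sum (φ φ' : ℝ → ℝ) (b : ℝ) (hb : 0 < b) (hc : ContinuousOn φ (Icc 0 b))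
    (hd : ∀ x ∈ Ioo 0 b, HasDerivAt φ (φ' x) x) (h0 : φ 0 = 0) (h1 : φ b = 1)
    (hp : ∀ x ∈ Ioo 0 b, 0 < φ x ∧ φ x < 1 ∧ 0 ≤ φ' x) (a : ℕ → ℝ)
    (ha : ∀ n, |a n| ≤ 1)
    (hs : ∀ x ∈ Ioo 0 b, HasSum (fun n => a n * (φ x ^ (2 * n) * φ' x)) 1) :
    ∫ x in (0:ℝ)..b, log (φ x) = - ∑' n : ℕ, a n / (2 * n + 1) ^ 2 := by
  have key := aux_int φ φ' b hb hc hd h0 h1 hp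
  have hsm : Summable (fun n : ℕ => 1 / (2 * (n:ℝ) + 1) ^ 2) := by
    have h := (Real.summable_one_div_nat_pow (p := 2)).2 (by norm_num)
    have h2 := (summable_nat_add_iff 1).2 h
    refine Summable.of_nonneg_of_le (fun n => by positivity) (fun n => ?_) h2
    push_cast
    gcongr
    have : (0:ℝ) ≤ n := by positivity
    linarith
  have H := hasSum_integral_of_summable_integral_norm (μ := volume.restrict (Ioo 0 b))
    (F := fun (n : ℕ) x => a n * (φ x ^ (2 * n) * φ' x * -log (φ x))) ?_ ?_
  · have e1 : ∀ n : ℕ, ∫ x in Ioo 0 b, a n * (φ x ^ (2 * n) * φ' x * -log (φ x))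
        = a n / (2 * n + 1) ^ 2 := by
      intro n
      rw [integral_const_mul, ← integral_Ioc_eq_integral_Ioo,
        ← intervalIntegral.integral_of_le hb.le, (key n).2]
      ring
    have e2 : ∫ x in Ioo 0 b, (∑' n : ℕ, a n * (φ x ^ (2 * n) * φ' x * -log (φ x)))
        = - ∫ x in (0:ℝ)..b, log (φ x) := by
      rw [intervalIntegral.integral_of_le hb.le, integral_Ioc_eq_integral_Ioo, ← integral_neg]
      apply setIntegral_congr_fun measurableSet_Ioo
      intro x hx
      have := ((hs x hx).mul_right (-log (φ x))).tsum_eq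
      simp only [one_mul] at this
      simp only [mul_assoc] at this ⊢
      exact this
    rw [e2] at H
    simp only [e1] at H
    rw [H.tsum_eq]; ring
  · intro n
    have := ((key n).1.const_mul (a n))
    rw [intervalIntegrable_iff_integrableOn_Ioo_of_le hb.le] at this
    exact this
  · refine Summable.of_nonneg_of_le (fun n => integral_nonneg fun _ => norm_nonneg _)
      (fun n => ?_) hsm
    have : ∫ x in Ioo 0 b, ‖a n * (φ x ^ (2 * n) * φ' x * -log (φ x))‖
        = |a n| * (1 / (2 * n + 1) ^ 2) := by
      rw [← (key n).2, intervalIntegral.integral_of_le hb.le, integral_Ioc_eq_integral_Ioo,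
        ← integral_const_mul]
      apply setIntegral_congr_fun measurableSet_Ioo
      intro x hx
      obtain ⟨a1, a2, a3⟩ := hp x hx
      have := Real.log_neg a1 a2
      have : 0 ≤ -log (φ x) := by linarith
      simp only [norm_mul, Real.norm_eq_abs (a n)]
      congr 1
      rw [← norm_mul, ← norm_mul, Real.norm_of_nonneg (by positivity)]
    rw [this]
    exact mul_le_of_le_one_left (by positivity) (ha n)

lemma aux_tan : ∫ x in (0:ℝ)..(π/4), log (tan x) = - ∑' n : ℕ, (-1 : ℝ) ^ n / (2 * n + 1) ^ 2 := by
  have hpi := Real.pi_pos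
  have hcos : ∀ x ∈ Icc 0 (π/4), 0 < cos x := fun x hx =>
    Real.cos_pos_of_mem_Ioo ⟨by linarith [hx.1], by linarith [hx.2]⟩
  have hb : ∀ x ∈ Ioo 0 (π/4), 0 < tan x ∧ tan x < 1 := by
    intro x hx
    refine ⟨Real.tan_pos_of_pos_of_lt_pi_div_two hx.1 (by linarith [hx.2]), ?_⟩
    rw [← Real.tan_pi_div_four]
    exact Real.tan_lt_tan_of_lt_of_lt_pi_div_two (by linarith [hx.1]) (by linarith) hx.2
  apply aux_sum tan (fun x => 1 / cos x ^ 2) (π/4) (by positivity)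
  · exact fun x hx => (Real.continuousAt_tan.2 (hcos x hx).ne').continuousWithinAt
  · exact fun x hx => Real.hasDerivAt_tan (hcos x (Ioo_subset_Icc_self hx)).ne'
  · simp
  · simp
  · exact fun x hx => ⟨(hb x hx).1, (hb x hx).2, by positivity⟩
  · intro n; simp
  · intro x hx
    obtain ⟨h1, h2⟩ := hb x hx
    have hc := hcos x (Ioo_subset_Icc_self hx)
    have h3 : |-(tan x ^ 2)| < 1 := by
      rw [abs_neg, abs_of_nonneg (by positivity)]; nlinarith
    have h := (hasSum_geometric_of_abs_lt_one h3).mul_right (1 / cos x ^ 2)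
    have hv : (1 - -tan x ^ 2)⁻¹ * (1 / cos x ^ 2) = 1 := by
      have := Real.inv_one_add_tan_sq hc.ne'
      rw [sub_neg_eq_add, this]
      field_simp
    rw [hv] at h
    have hf : (fun n : ℕ => (-1 : ℝ) ^ n * (tan x ^ (2 * n) * (1 / cos x ^ 2)))
        = fun n : ℕ => (-tan x ^ 2) ^ n * (1 / cos x ^ 2) := by
      ext n
      rw [neg_pow (tan x ^ 2), ← pow_mul]; ring
    rw [hf]
    exact h

lemma aux_sin : ∫ x in (0:ℝ)..(π/4), log (√2 * sin x)
    = - ∑' n : ℕ, (((2 * n).choose n : ℝ) / (8 ^ n * √2)) / (2 * n + 1) ^ 2 := by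
  have hpi := Real.pi_pos
  have h2 : √2 * √2 = 2 := Real.mul_self_sqrt (by norm_num)
  have hs2 : 1 ≤ √2 := Real.one_le_sqrt.2 (by norm_num)
  have hcos : ∀ x ∈ Icc 0 (π/4), 0 < cos x := fun x hx =>
    Real.cos_pos_of_mem_Ioo ⟨by linarith [hx.1], by linarith [hx.2]⟩
  have hend : √2 * sin (π/4) = 1 := by
    rw [Real.sin_pi_div_four]; linarith
  have hb : ∀ x ∈ Ioo 0 (π/4), 0 < √2 * sin x ∧ √2 * sin x < 1 := by
    intro x hx
    have := Real.sin_pos_of_pos_of_lt_pi hx.1 (by linarith [hx.2])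
    refine ⟨by positivity, ?_⟩
    rw [← hend]
    gcongr
    exact Real.sin_lt_sin_of_lt_of_le_pi_div_two (by linarith [hx.1]) (by linarith) hx.2
  apply aux_sum (fun x => √2 * sin x) (fun x => √2 * cos x) (π/4) (by positivity)
  · fun_prop
  · exact fun x hx => (Real.hasDerivAt_sin x).const_mul _
  · simp
  · exact hend
  · exact fun x hx => ⟨(hb x hx).1, (hb x hx).2,
      by have := hcos x (Ioo_subset_Icc_self hx); positivity⟩
  · intro n
    rw [abs_of_nonneg (by positivity), div_le_one (by positivity)]
    have h := Nat.centralBinom_le_four_pow n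
    rw [Nat.centralBinom_eq_two_mul_choose] at h
    calc ((2 * n).choose n : ℝ) ≤ 4 ^ n := by exact_mod_cast h
      _ ≤ 8 ^ n := by gcongr; norm_num
      _ ≤ 8 ^ n * √2 := le_mul_of_one_le_right (by positivity) hs2
  · intro x hx
    have hc := hcos x (Ioo_subset_Icc_self hx)
    obtain ⟨h1, h3⟩ := hb x hx
    have hlt : sin x ^ 2 < 1 := by nlinarith [Real.sin_sq_add_cos_sq x]
    have h := (aux_gen (sq_nonneg (sin x)) hlt).mul_right (cos x)
    have hcc : √(1 - sin x ^ 2) = cos x := by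
      rw [← Real.cos_sq', Real.sqrt_sq hc.le]
    rw [hcc] at h
    rw [one_div_mul_cancel hc.ne'] at h
    have hf : (fun n : ℕ => ((2 * n).choose n : ℝ) / (8 ^ n * √2)
          * ((√2 * sin x) ^ (2 * n) * (√2 * cos x)))
        = fun n : ℕ => ((2 * n).choose n : ℝ) / 4 ^ n * (sin x ^ 2) ^ n * cos x := by
      ext n
      have e : (√2 * sin x) ^ (2 * n) = 2 ^ n * (sin x ^ 2) ^ n := by
        rw [pow_mul, mul_pow, Real.sq_sqrt (by norm_num), mul_pow]
      have e8 : (8:ℝ) ^ n = 4 ^ n * 2 ^ n := by rw [← mul_pow]; norm_num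
      rw [e, e8]
      field_simp
    rw [hf]
    exact h

theorem sum_central_binom_8pow :
    ∑' n : ℕ, ((2 * n).choose n : ℝ) / ((2 * n + 1) ^ 2 * 8 ^ n)
      = Real.sqrt 2 * (Real.pi * Real.log 2 / 8 +
          (∑' n : ℕ, (-1 : ℝ) ^ n / (2 * n + 1) ^ 2) / 2) := by
  have hpi := Real.pi_pos
  have hsin : ∀ x ∈ Ioo 0 (π/4), 0 < sin x := fun x hx =>
    Real.sin_pos_of_pos_of_lt_pi hx.1 (by linarith [hx.2])
  have hcos : ∀ x ∈ Ioo 0 (π/4), 0 < cos x := fun x hx =>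
    Real.cos_pos_of_mem_Ioo ⟨by linarith [hx.1], by linarith [hx.2]⟩
  have A := aux_tan
  have B := aux_sin
  have C := integral_log_sin_zero_pi_div_two
  have his : ∀ a b, IntervalIntegrable (fun x => log (sin x)) volume a b :=
    fun a b => intervalIntegrable_log_sin
  have hic : ∀ a b, IntervalIntegrable (fun x => log (cos x)) volume a b :=
    fun a b => intervalIntegrable_log_cos
  have D : ∫ x in (π/4)..(π/2), log (sin x) = ∫ x in (0:ℝ)..(π/4), log (cos x) := by
    have := intervalIntegral.integral_comp_sub_left (a := 0) (b := π/4)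
      (fun x => log (sin x)) (π/2)
    simp only [Real.sin_pi_div_two_sub] at this
    rw [this]; congr 1 <;> ring
  rw [← intervalIntegral.integral_add_adjacent_intervals (his 0 (π/4)) (his (π/4) (π/2)), D] at C
  have A' : ∫ x in (0:ℝ)..(π/4), log (tan x)
      = (∫ x in (0:ℝ)..(π/4), log (sin x)) - ∫ x in (0:ℝ)..(π/4), log (cos x) := by
    rw [← intervalIntegral.integral_sub (his _ _) (hic _ _)]
    simp only [intervalIntegral.integral_of_le (show (0:ℝ) ≤ π/4 by positivity),
      integral_Ioc_eq_integral_Ioo]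
    apply setIntegral_congr_fun measurableSet_Ioo
    intro x hx
    simp only [Real.tan_eq_sin_div_cos]
    exact Real.log_div (hsin x hx).ne' (hcos x hx).ne'
  have B' : ∫ x in (0:ℝ)..(π/4), log (√2 * sin x)
      = π/4 * (log 2 / 2) + ∫ x in (0:ℝ)..(π/4), log (sin x) := by
    have : π/4 * (log 2 / 2) = ∫ x in (0:ℝ)..(π/4), log 2 / 2 := by simp; ring
    rw [this, ← intervalIntegral.integral_add (by simp) (his _ _)]
    simp only [intervalIntegral.integral_of_le (show (0:ℝ) ≤ π/4 by positivity),
      integral_Ioc_eq_integral_Ioo]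
    apply setIntegral_congr_fun measurableSet_Ioo
    intro x hx
    simp only []
    rw [Real.log_mul (by positivity) (hsin x hx).ne', Real.log_sqrt (by norm_num)]
  have E : ∑' n : ℕ, ((2 * n).choose n : ℝ) / ((2 * n + 1) ^ 2 * 8 ^ n)
      = √2 * ∑' n : ℕ, (((2 * n).choose n : ℝ) / (8 ^ n * √2)) / (2 * n + 1) ^ 2 := by
    rw [← tsum_mul_left]
    congr 1; ext n
    field_simp
  rw [E]
  congr 1
  linarith
end

section
/- The sum ∑_{n=1}^∞ C(2n,n) / (n² · 4^n) equals π²/6 - 2·(log 2)². -/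
noncomputable section

/-- Power series with real coefficients. -/
def psr (a : ℕ → ℝ) (x : ℝ) : ℝ := ∑' n : ℕ, a n * x ^ n

/-- Coefficients of the derivative. -/
def dco (a : ℕ → ℝ) (n : ℕ) : ℝ := (n + 1) * a (n + 1)

/-- Normalised central binomial coefficients. -/
def cb (n : ℕ) : ℝ := (Nat.centralBinom n : ℝ) / 4 ^ n

lemma hd_of {f g : ℝ → ℝ} {d e x : ℝ} (h : HasDerivAt f d x) (hfg : ∀ y, f y = g y)
    (hde : e = d) : HasDerivAt g e x := by
  have : f = g := funext hfg
  rw [hde, ← this]; exact h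

lemma hs_of {f g : ℕ → ℝ} {s t : ℝ} (h : HasSum f s) (hfg : ∀ n, g n = f n)
    (hst : t = s) : HasSum g t := by
  have : g = f := funext hfg
  rw [hst, this]; exact h

lemma psr_summable {a : ℕ → ℝ} (ha : ∀ n, |a n| ≤ 1) {x : ℝ} (hx : |x| < 1) :
    Summable (fun n => a n * x ^ n) := by
  refine Summable.of_norm_bounded (g := fun n => |x| ^ n)
    (summable_geometric_of_lt_one (abs_nonneg x) hx) ?_
  intro n
  rw [Real.norm_eq_abs, abs_mul, abs_pow]
  exact mul_le_of_le_one_left (by positivity) (ha n)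

lemma psr_summable_n {a : ℕ → ℝ} (ha : ∀ n, |a n| ≤ 1) {x : ℝ} (hx : |x| < 1) :
    Summable (fun n : ℕ => (n * a n) * x ^ (n - 1)) := by
  rw [← summable_nat_add_iff 1]
  have h1 : Summable (fun n : ℕ => ((n : ℝ) * |x| ^ n + |x| ^ n)) := by
    have := summable_pow_mul_geometric_of_norm_lt_one (R := ℝ) 1 (r := |x|) (by simpa using hx)
    simp only [pow_one] at this
    exact this.add (summable_geometric_of_lt_one (abs_nonneg x) hx)
  refine Summable.of_norm_bounded h1 ?_
  intro n
  rw [Real.norm_eq_abs, abs_mul, abs_mul, abs_pow]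
  have h2 : |((n + 1 : ℕ) : ℝ)| = n + 1 := by
    rw [abs_of_nonneg (by positivity)]; push_cast; ring
  rw [h2]
  have := ha (n + 1)
  have h3 : (n + 1 : ℝ) * |a (n + 1)| ≤ n + 1 := mul_le_of_le_one_right (by positivity) this
  calc (n + 1 : ℝ) * |a (n + 1)| * |x| ^ (n + 1 - 1) ≤ (n + 1) * |x| ^ n := by
        simp only [Nat.add_sub_cancel]
        gcongr
    _ = _ := by ring

lemma psr_hasDerivAt {a : ℕ → ℝ} (ha : ∀ n, |a n| ≤ 1) {x : ℝ} (hx : |x| < 1) :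
    HasDerivAt (psr a) (psr (dco a) x) x := by
  obtain ⟨r, hxr, hr1⟩ := exists_between hx
  have hr0 : 0 ≤ r := (abs_nonneg x).trans hxr.le
  have hr : |r| < 1 := by rwa [abs_of_nonneg hr0]
  have hb : Summable (fun n : ℕ => (n : ℝ) * 1 * r ^ (n - 1)) :=
    psr_summable_n (a := fun _ => 1) (by simp) hr
  have key := hasDerivAt_tsum_of_isPreconnected (𝕜 := ℝ) (g := fun n y => a n * y ^ n)
    (g' := fun n y => (n * a n) * y ^ (n - 1)) (t := Set.Ioo (-r) r) (y₀ := x) (y := x)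
    hb isOpen_Ioo isPreconnected_Ioo
    (fun n y _ => by
      have := (hasDerivAt_pow n y).const_mul (a n)
      refine hd_of this (fun _ => rfl) ?_; ring)
    (fun n y hy => by
      have hy' : |y| ≤ r := abs_le.2 ⟨hy.1.le, hy.2.le⟩
      rw [Real.norm_eq_abs, abs_mul, abs_mul, abs_pow, abs_of_nonneg (Nat.cast_nonneg n)]
      gcongr
      exact ha n)
    (abs_lt.1 hxr) (psr_summable ha hx) (abs_lt.1 hxr)
  refine hd_of key (fun _ => rfl) ?_
  rw [(psr_summable_n ha hx).tsum_eq_zero_add]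
  simp [psr, dco]

lemma dco_summable {a : ℕ → ℝ} (ha : ∀ n, |a n| ≤ 1) {x : ℝ} (hx : |x| < 1) :
    Summable (fun n => dco a n * x ^ n) := by
  have := (summable_nat_add_iff 1).2 (psr_summable_n ha hx)
  simpa [dco] using this

lemma psr_zero (a : ℕ → ℝ) : psr a 0 = a 0 := by
  unfold psr
  rw [tsum_eq_single 0]
  · simp
  · intro n hn; simp [hn]

lemma psr_continuousOn {a : ℕ → ℝ} (ha : Summable (fun n => |a n|)) :
    ContinuousOn (psr a) (Set.Icc 0 1) := by
  unfold psr
  refine continuousOn_tsum (fun n => by fun_prop) ha ?_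
  intro n x hx
  rw [Real.norm_eq_abs, abs_mul, abs_pow, abs_of_nonneg hx.1]
  exact mul_le_of_le_one_right (abs_nonneg _) (pow_le_one₀ hx.1 hx.2)

lemma const_aux {f : ℝ → ℝ} {a b : ℝ} (hab : a < b) (hc : ContinuousOn f (Set.Icc a b))
    (hd : ∀ x ∈ Set.Ioo a b, HasDerivAt f 0 x) : f b = f a := by
  obtain ⟨c, _, h⟩ := exists_hasDerivAt_eq_slope f (fun _ => 0) hab hc hd
  have : b - a ≠ 0 := by linarith
  field_simp at h
  linarith

lemma cb_zero : cb 0 = 1 := by simp [cb]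

lemma cb_nonneg (n : ℕ) : 0 ≤ cb n := by unfold cb; positivity

lemma cb_succ (n : ℕ) : (n + 1 : ℝ) * cb (n + 1) = (n + 1 / 2) * cb n := by
  have h : ((n + 1 : ℕ) : ℝ) * Nat.centralBinom (n + 1) = 2 * (2 * n + 1) * Nat.centralBinom n := by
    exact_mod_cast Nat.succ_mul_centralBinom_succ n
  push_cast at h
  unfold cb
  rw [pow_succ, ← mul_div_assoc, h]
  field_simp
  ring

lemma cb_le (n : ℕ) : cb n ≤ 1 := by
  induction n with
  | zero => simp [cb]
  | succ n ih =>
    have h := cb_succ n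
    have h0 := cb_nonneg n
    have : (0 : ℝ) ≤ n := Nat.cast_nonneg n
    nlinarith

lemma cb_abs (n : ℕ) : |cb n| ≤ 1 := by
  rw [abs_of_nonneg (cb_nonneg n)]; exact cb_le n

def cb1 (n : ℕ) : ℝ := cb n / n
def cb2 (n : ℕ) : ℝ := cb n / n ^ 2
def li (n : ℕ) : ℝ := 1 / (n : ℝ) ^ 2

lemma cb1_abs (n : ℕ) : |cb1 n| ≤ 1 := by
  rcases n with _ | n
  · simp [cb1]
  · unfold cb1
    rw [abs_div]
    refine div_le_one_of_le₀ ((cb_abs _).trans ?_) (abs_nonneg _)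
    rw [abs_of_nonneg (by positivity)]; push_cast; linarith [Nat.cast_nonneg (α := ℝ) n]

lemma li_nonneg (n : ℕ) : 0 ≤ li n := by unfold li; positivity

lemma li_abs (n : ℕ) : |li n| ≤ 1 := by
  rw [abs_of_nonneg (li_nonneg n)]
  rcases n with _ | n
  · simp [li]
  · unfold li
    refine div_le_one_of_le₀ ?_ (by positivity)
    push_cast; nlinarith [Nat.cast_nonneg (α := ℝ) n]

lemma cb2_eq (n : ℕ) : cb2 n = cb n * li n := by simp [cb2, li, div_eq_mul_inv]

lemma cb2_abs_le (n : ℕ) : |cb2 n| ≤ li n := by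
  rw [cb2_eq, abs_mul, abs_of_nonneg (li_nonneg n)]
  exact mul_le_of_le_one_left (li_nonneg n) (cb_abs n)

lemma cb2_abs (n : ℕ) : |cb2 n| ≤ 1 := by
  rw [cb2_eq, abs_mul]
  exact mul_le_one₀ (cb_abs n) (abs_nonneg _) (li_abs n)

lemma li_summable : Summable (fun n => |li n|) := by
  simp_rw [abs_of_nonneg (li_nonneg _)]
  exact hasSum_zeta_two.summable

lemma cb2_summable : Summable (fun n => |cb2 n|) := by
  refine Summable.of_nonneg_of_le (fun _ => abs_nonneg _) cb2_abs_le hasSum_zeta_two.summable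

/-- x times the derivative. -/
lemma x_mul_dco {a : ℕ → ℝ} (ha : ∀ n, |a n| ≤ 1) {x : ℝ} (hx : |x| < 1) :
    HasSum (fun n : ℕ => (n * a n) * x ^ n) (x * psr (dco a) x) := by
  rw [← hasSum_nat_add_iff' 1]
  simp only [Finset.range_one, Finset.sum_singleton, Nat.cast_zero, zero_mul, sub_zero]
  have := (dco_summable ha hx).hasSum.mul_left x
  refine hs_of this (fun n => ?_) rfl
  simp only [dco]; push_cast; ring

lemma A_ode {x : ℝ} (hx : |x| < 1) :
    2 * (1 - x) * psr (dco cb) x = psr cb x := by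
  have h1 := x_mul_dco cb_abs hx
  have h2 := (psr_summable cb_abs hx).hasSum.mul_left (1 / 2)
  have h3 := (dco_summable cb_abs hx).hasSum
  have h4 := h1.add h2
  have : (fun n : ℕ => (n * cb n) * x ^ n + 1 / 2 * (cb n * x ^ n)) = fun n => dco cb n * x ^ n := by
    funext n
    simp only [dco, cb_succ]; ring
  rw [this] at h4
  have h5 := h4.unique h3
  change _ + 1 / 2 * psr cb x = psr (dco cb) x at h5
  linarith

lemma L_ode {x : ℝ} (hx : |x| < 1) : x * psr (dco cb1) x = psr cb x - 1 := by
  have h1 := x_mul_dco cb1_abs hx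
  have h2 := (psr_summable cb_abs hx).hasSum
  rw [← hasSum_nat_add_iff' 1] at h1 h2
  simp only [Finset.range_one, Finset.sum_singleton, Nat.cast_zero, zero_mul, sub_zero, cb_zero,
    pow_zero, one_mul] at h1 h2
  refine h1.unique ?_
  refine hs_of h2 (fun n => ?_) rfl
  unfold cb1
  have : ((n + 1 : ℕ) : ℝ) ≠ 0 := by positivity
  field_simp

lemma F_ode {x : ℝ} (hx : |x| < 1) : x * psr (dco cb2) x = psr cb1 x := by
  have h1 := x_mul_dco cb2_abs hx
  have h2 := (psr_summable cb1_abs hx).hasSum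
  refine h1.unique ?_
  refine hs_of h2 (fun n => ?_) rfl
  unfold cb2 cb1
  rcases n with _ | n
  · simp
  · have : ((n + 1 : ℕ) : ℝ) ≠ 0 := by positivity
    field_simp

lemma li_ode {x : ℝ} (hx : |x| < 1) : x * psr (dco li) x = - Real.log (1 - x) := by
  have h1 := x_mul_dco li_abs hx
  have h2 := Real.hasSum_pow_div_log_of_abs_lt_one hx
  rw [← hasSum_nat_add_iff' 1] at h1
  simp only [Finset.range_one, Finset.sum_singleton, Nat.cast_zero, zero_mul, sub_zero] at h1
  refine h1.unique ?_
  refine hs_of h2 (fun n => ?_) rfl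
  unfold li
  push_cast
  have : (n + 1 : ℝ) ≠ 0 := by positivity
  field_simp

lemma xu_lt {u : ℝ} (h0 : 0 ≤ u) (h1 : u < 1 / 2) : |4 * u * (1 - u)| < 1 := by
  rw [abs_of_nonneg (by nlinarith)]
  nlinarith [sq_pos_of_pos (show 0 < 1 - 2 * u by linarith)]

lemma xu_deriv (u : ℝ) : HasDerivAt (fun u : ℝ => 4 * u * (1 - u)) (4 * (1 - 2 * u)) u := by
  have := ((hasDerivAt_id u).const_mul 4).mul ((hasDerivAt_id u).const_sub 1)
  refine hd_of this (fun _ => rfl) ?_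
  simp; ring

lemma psr_xu_deriv {a : ℕ → ℝ} (ha : ∀ n, |a n| ≤ 1) {u : ℝ} (h0 : 0 ≤ u) (h1 : u < 1 / 2) :
    HasDerivAt (fun u : ℝ => psr a (4 * u * (1 - u)))
      (psr (dco a) (4 * u * (1 - u)) * (4 * (1 - 2 * u))) u :=
  HasDerivAt.comp (h₂ := psr a) (h := fun u : ℝ => 4 * u * (1 - u)) u
    (psr_hasDerivAt ha (xu_lt h0 h1)) (xu_deriv u)

lemma A_eq {u : ℝ} (h0 : 0 < u) (h1 : u < 1 / 2) :
    psr cb (4 * u * (1 - u)) * (1 - 2 * u) = 1 := by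
  have hd : ∀ v, 0 ≤ v → v < 1 / 2 →
      HasDerivAt (fun v : ℝ => psr cb (4 * v * (1 - v)) * (1 - 2 * v)) 0 v := by
    intro v hv0 hv1
    have := (psr_xu_deriv cb_abs hv0 hv1).mul (((hasDerivAt_id v).const_mul 2).const_sub 1)
    refine hd_of this (fun _ => rfl) ?_
    have h := A_ode (xu_lt hv0 hv1)
    simp only [id]
    rw [← h]; ring
  have := const_aux h0
    (fun v hv => (hd v hv.1 (hv.2.trans_lt h1)).continuousAt.continuousWithinAt)
    (fun v hv => hd v hv.1.le (hv.2.trans h1))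
  rw [this]
  simp [psr_zero, cb_zero]

lemma log_deriv {u : ℝ} (h1 : u < 1) :
    HasDerivAt (fun u : ℝ => Real.log (1 - u)) (-1 / (1 - u)) u :=
  ((hasDerivAt_id u).const_sub 1).log (by simp only [id]; linarith)

lemma L_eq {u : ℝ} (h0 : 0 < u) (h1 : u < 1 / 2) :
    psr cb1 (4 * u * (1 - u)) = - 2 * Real.log (1 - u) := by
  have hd : ∀ v, 0 ≤ v → v < 1 / 2 →
      HasDerivAt (fun v : ℝ => psr cb1 (4 * v * (1 - v)) + 2 * Real.log (1 - v))
       (psr (dco cb1) (4 * v * (1 - v)) * (4 * (1 - 2 * v)) + 2 * (-1 / (1 - v))) v := by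
    intro v hv0 hv1
    exact (psr_xu_deriv cb1_abs hv0 hv1).add ((log_deriv (by linarith)).const_mul 2)
  have := const_aux h0
    (fun v hv => (hd v hv.1 (hv.2.trans_lt h1)).continuousAt.continuousWithinAt)
    (fun v hv => by
      have hv1 := hv.2.trans h1
      have hv0 := hv.1
      refine hd_of (hd v hv0.le hv1) (fun _ => rfl) ?_
      have hL := L_ode (xu_lt hv0.le hv1)
      have hA := A_eq hv0 hv1
      have e1 : 1 - v ≠ 0 := by linarith
      have e2 : v ≠ 0 := hv0.ne'
      have : v * (psr (dco cb1) (4 * v * (1 - v)) * (4 * (1 - 2 * v)) * (1 - v) - 2) = 0 := by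
        linear_combination (1 - 2 * v) * hL + hA
      have h3 := (mul_eq_zero.1 this).resolve_left e2
      field_simp
      linarith)
  simp [psr_zero, cb1] at this
  linarith

lemma F_one : psr cb2 1 = 2 * psr li (1 / 2) - Real.log 2 ^ 2 := by
  have hm1 : Set.MapsTo (fun u : ℝ => 4 * u * (1 - u)) (Set.Icc 0 (1 / 2)) (Set.Icc 0 1) := by
    intro u hu
    obtain ⟨h0, h1⟩ := hu
    constructor
    · simp only; nlinarith
    · simp only; nlinarith [sq_nonneg (1 - 2 * u)]
  have hc1 := (psr_continuousOn cb2_summable).comp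
    (f := fun u : ℝ => 4 * u * (1 - u)) (by fun_prop) hm1
  have hc2 : ContinuousOn (psr li) (Set.Icc 0 (1 / 2)) :=
    (psr_continuousOn li_summable).mono (Set.Icc_subset_Icc le_rfl (by norm_num))
  have hc3 : ContinuousOn (fun u : ℝ => Real.log (1 - u)) (Set.Icc 0 (1 / 2)) :=
    fun u hu => (log_deriv (by linarith [hu.2])).continuousAt.continuousWithinAt
  have := const_aux (f := fun u => psr cb2 (4 * u * (1 - u)) - 2 * psr li u + Real.log (1 - u) ^ 2)
    (show (0 : ℝ) < 1 / 2 by norm_num)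
    ((hc1.sub (hc2.const_mul 2)).add (hc3.pow 2))
    (fun v hv => by
      obtain ⟨h0, h1⟩ := hv
      have hv1 : |v| < 1 := by rw [abs_of_pos h0]; linarith
      have := ((psr_xu_deriv cb2_abs h0.le h1).sub ((psr_hasDerivAt li_abs hv1).const_mul 2)).add
        ((log_deriv (show v < 1 by linarith)).pow 2)
      refine hd_of this (fun _ => rfl) ?_
      have hF := F_ode (xu_lt h0.le h1)
      rw [L_eq h0 h1] at hF
      have hl := li_ode hv1
      have e1 : 1 - v ≠ 0 := by linarith
      have e2 : v ≠ 0 := h0.ne'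
      have e3 : psr (dco li) v = - Real.log (1 - v) / v := by field_simp; linarith
      have e4 : psr (dco cb2) (4 * v * (1 - v)) = -2 * Real.log (1 - v) / (4 * v * (1 - v)) := by
        field_simp; linarith
      rw [e3, e4]
      field_simp
      norm_num
      ring)
  norm_num [psr_zero, cb2, li] at this
  have hl : Real.log (1 / 2) = - Real.log 2 := by rw [one_div, Real.log_inv]
  rw [hl] at this
  change psr cb2 1 - 2 * psr li (1 / 2) + _ = _ at this
  linarith

lemma li_one : psr li 1 = Real.pi ^ 2 / 6 := by
  have := hasSum_zeta_two.tsum_eq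
  simpa [psr, li] using this

lemma dco_li_abs (n : ℕ) : |dco li n| ≤ 1 := by
  have : dco li n = 1 / (n + 1) := by
    unfold dco li
    push_cast
    have : (n + 1 : ℝ) ≠ 0 := by positivity
    field_simp
  rw [this, abs_of_nonneg (by positivity)]
  exact div_le_one_of_le₀ (by linarith [Nat.cast_nonneg (α := ℝ) n]) (by positivity)

lemma li_half : 2 * psr li (1 / 2) = Real.pi ^ 2 / 6 - Real.log 2 ^ 2 := by
  have hc2 : ContinuousOn (psr li) (Set.Icc 0 (1 / 2)) :=
    (psr_continuousOn li_summable).mono (Set.Icc_subset_Icc le_rfl (by norm_num))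
  have hc1 : ContinuousOn (fun u => psr li (1 - u)) (Set.Icc 0 (1 / 2)) :=
    (psr_continuousOn li_summable).comp (f := fun u : ℝ => 1 - u) (by fun_prop)
      (fun u hu => ⟨by linarith [hu.2], by linarith [hu.1]⟩)
  have hlt : ∀ u ∈ Set.Icc (0 : ℝ) (1 / 2), |u| < 1 := fun u hu => by
    rw [abs_of_nonneg hu.1]; linarith [hu.2]
  have hc3 : ContinuousOn (fun u : ℝ => Real.log u * Real.log (1 - u)) (Set.Icc 0 (1 / 2)) := by
    have h : ContinuousOn (fun u : ℝ => -((u * Real.log u) * psr (dco li) u))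
        (Set.Icc 0 (1 / 2)) :=
      (Real.continuous_mul_log.continuousOn.mul
        (fun u hu => (psr_hasDerivAt dco_li_abs (hlt u hu)).continuousAt.continuousWithinAt)).neg
    refine h.congr ?_
    intro u hu
    have := li_ode (hlt u hu)
    simp only
    linear_combination (Real.log u) * this
  have := const_aux (f := fun u => psr li u + psr li (1 - u) + Real.log u * Real.log (1 - u))
    (show (0 : ℝ) < 1 / 2 by norm_num) ((hc2.add hc1).add hc3)
    (fun v hv => by
      obtain ⟨h0, h1⟩ := hv
      have hv1 : |v| < 1 := by rw [abs_of_pos h0]; linarith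
      have hv2 : |1 - v| < 1 := by rw [abs_of_pos (by linarith)]; linarith
      have := ((psr_hasDerivAt li_abs hv1).add
        ((psr_hasDerivAt li_abs hv2).comp v ((hasDerivAt_id v).const_sub 1))).add
        ((Real.hasDerivAt_log h0.ne').mul (log_deriv (show v < 1 by linarith)))
      refine hd_of this (fun _ => rfl) ?_
      have hl := li_ode hv1
      have hl2 := li_ode hv2
      rw [sub_sub_cancel] at hl2
      have e1 : 1 - v ≠ 0 := by linarith
      have e2 : v ≠ 0 := h0.ne'
      have e3 : psr (dco li) v = - Real.log (1 - v) / v := by field_simp; linarith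
      have e4 : psr (dco li) (1 - v) = - Real.log v / (1 - v) := by field_simp; linarith
      rw [e3, e4]
      field_simp
      ring)
  have hl : Real.log (1 / 2) = - Real.log 2 := by rw [one_div, Real.log_inv]
  have hh : (1 : ℝ) - 1 / 2 = 1 / 2 := by norm_num
  simp only [hh, hl, sub_zero, psr_zero, Real.log_zero, zero_mul, li_one] at this
  have h0 : li 0 = 0 := by simp [li]
  rw [h0] at this
  linarith

end

theorem sum_central_binom_div_n_sq :
    ∑' n : ℕ, ((2 * (n + 1)).choose (n + 1) : ℝ) / ((n + 1) ^ 2 * 4 ^ (n + 1))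
      = Real.pi ^ 2 / 6 - 2 * Real.log 2 ^ 2 := by
  have h := F_one
  rw [li_half] at h
  have hs : Summable (fun n => cb2 n * (1 : ℝ) ^ n) := by
    simpa using cb2_summable.of_abs
  unfold psr at h
  rw [hs.tsum_eq_zero_add] at h
  have e : ∀ n : ℕ, cb2 (n + 1) * (1 : ℝ) ^ (n + 1)
      = ((2 * (n + 1)).choose (n + 1) : ℝ) / ((n + 1) ^ 2 * 4 ^ (n + 1)) := by
    intro n
    simp only [cb2, cb, Nat.centralBinom, one_pow, mul_one]
    push_cast
    rw [div_div, mul_comm ((4 : ℝ) ^ (n + 1))]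
  simp only [e] at h
  have h0 : cb2 0 = 0 := by simp [cb2]
  rw [h0] at h
  linarith
end

section
/- The sum ∑_{n=0}^∞ C(2n,n) / ((n+1)³ · 4^n) equals 8 - 8·log 2 - π²/3 + 4·(log 2)². -/
noncomputable def cbS (c : ℕ → ℝ) (x : ℝ) : ℝ := ∑' n : ℕ, c n * x ^ n

noncomputable def cbT (c : ℕ → ℝ) (x : ℝ) : ℝ := ∑' n : ℕ, c n / (n + 1) * x ^ (n + 1)

noncomputable def cbA (n : ℕ) : ℝ := ((2 * n).choose n : ℝ) / 4 ^ n

lemma cb_bound (c : ℕ → ℝ) (hc : ∀ n, |c n| ≤ 1) (n : ℕ) : |c n / (n + 1)| ≤ 1 := by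
  rw [abs_div, abs_of_pos (by positivity : (0 : ℝ) < (n : ℝ) + 1)]
  rw [div_le_one (by positivity)]
  have := hc n
  have h2 : (0 : ℝ) ≤ n := by positivity
  linarith

lemma cbT_zero (c : ℕ → ℝ) : cbT c 0 = 0 := by simp [cbT]

lemma cbS_summable (c : ℕ → ℝ) (hc : ∀ n, |c n| ≤ 1) {x : ℝ} (hx : |x| < 1) :
    Summable fun n : ℕ => c n * x ^ n := by
  refine Summable.of_norm_bounded (summable_geometric_of_abs_lt_one (r := |x|) (by simpa using hx)) ?_
  intro n
  rw [Real.norm_eq_abs, abs_mul, abs_pow]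
  exact mul_le_of_le_one_left (by positivity) (hc n)

lemma cbT_eq (c : ℕ → ℝ) (x : ℝ) : cbT c x = x * cbS (fun n => c n / (n + 1)) x := by
  rw [cbT, cbS, ← tsum_mul_left]
  congr 1; ext n; ring

lemma cbT_hasDerivAt (c : ℕ → ℝ) (hc : ∀ n, |c n| ≤ 1) {x : ℝ} (hx : |x| < 1) :
    HasDerivAt (cbT c) (cbS c x) x := by
  obtain ⟨r, hxr, hr1⟩ := exists_between hx
  have hr0 : 0 < r := lt_of_le_of_lt (abs_nonneg x) hxr
  refine hasDerivAt_tsum_of_isPreconnected (u := fun n : ℕ => r ^ n)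
    (g := fun (n : ℕ) y => c n / (n + 1) * y ^ (n + 1)) (g' := fun (n : ℕ) y => c n * y ^ n)
    (t := Set.Ioo (-r) r) (y₀ := 0)
    (summable_geometric_of_lt_one hr0.le hr1) isOpen_Ioo isPreconnected_Ioo ?_ ?_ ?_ ?_ ?_
  · intro n y _
    have h := (hasDerivAt_pow (n + 1) y).const_mul (c n / ((n : ℝ) + 1))
    refine h.congr_deriv ?_
    have : (n : ℝ) + 1 ≠ 0 := by positivity
    push_cast
    field_simp
  · intro n y hy
    rw [Real.norm_eq_abs, abs_mul, abs_pow]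
    have hy' : |y| ≤ r := (abs_lt.2 hy).le
    calc |c n| * |y| ^ n ≤ 1 * r ^ n := by
          gcongr
          exact hc n
      _ = r ^ n := one_mul _
  · exact ⟨by linarith, hr0⟩
  · simp [summable_zero]
  · exact abs_lt.1 hxr

lemma cbS_cont_half (c : ℕ → ℝ) (hc : ∀ n, |c n| ≤ 1) :
    ContinuousOn (cbS c) (Set.Icc 0 (1 / 2)) := by
  refine continuousOn_tsum (u := fun n : ℕ => (1 / 2 : ℝ) ^ n) ?_ ?_ ?_
  · intro n; fun_prop
  · exact summable_geometric_of_lt_one (by norm_num) (by norm_num)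
  · intro n x hx
    rw [Real.norm_eq_abs, abs_mul, abs_pow, abs_of_nonneg hx.1]
    calc |c n| * x ^ n ≤ 1 * (1 / 2) ^ n := by
          gcongr
          · exact pow_nonneg hx.1 n
          · exact hc n
          · exact hx.1
          · exact hx.2
      _ = _ := one_mul _

lemma cb_summable_sq : Summable fun n : ℕ => 1 / ((n : ℝ) + 1) ^ 2 := by
  have := (summable_nat_add_iff 1).2 (Real.summable_one_div_nat_pow.2 (by norm_num : 1 < 2))
  simpa using this

lemma cbT_cont (c : ℕ → ℝ) (hc : ∀ n, |c n| ≤ 1) :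
    ContinuousOn (cbT (fun n => c n / (n + 1))) (Set.Icc 0 1) := by
  refine continuousOn_tsum (u := fun n : ℕ => 1 / ((n : ℝ) + 1) ^ 2) ?_ cb_summable_sq ?_
  · intro n; fun_prop
  · intro n x hx
    rw [Real.norm_eq_abs, abs_mul, abs_pow, abs_of_nonneg hx.1, div_div, abs_div,
      abs_of_pos (by positivity : (0 : ℝ) < ((n : ℝ) + 1) * (n + 1)), ← sq]
    have h1 : |c n| / ((n : ℝ) + 1) ^ 2 ≤ 1 / ((n : ℝ) + 1) ^ 2 := by
      gcongr
      exact hc n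
    have h2 : x ^ (n + 1) ≤ 1 := pow_le_one₀ hx.1 hx.2
    exact (mul_le_of_le_one_right (by positivity) h2).trans h1

lemma cb_const {f : ℝ → ℝ} {b : ℝ} (hb : 0 < b) (hc : ContinuousOn f (Set.Icc 0 b))
    (hd : ∀ x ∈ Set.Ioo 0 b, HasDerivAt f 0 x) : f b = f 0 := by
  obtain ⟨c, _, h⟩ := exists_hasDerivAt_eq_slope f (fun _ => 0) hb hc hd
  have : b - 0 ≠ 0 := by linarith
  field_simp at h
  linarith

/-! Dilogarithm at one half -/

lemma cb_log {x : ℝ} (hx : |x| < 1) : cbT (fun _ => 1) x = - Real.log (1 - x) := by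
  have := (Real.hasSum_pow_div_log_of_abs_lt_one hx).tsum_eq
  rw [← this, cbT]
  congr 1; ext n; ring

noncomputable def cbL : ℝ → ℝ := cbT (fun n => 1 / (n + 1))

lemma cb_one (n : ℕ) : |(fun _ : ℕ => (1 : ℝ)) n| ≤ 1 := by simp

lemma cb_inv (n : ℕ) : |(fun n : ℕ => (1 : ℝ) / (n + 1)) n| ≤ 1 := cb_bound (fun _ => 1) cb_one n

lemma cbL_cont : ContinuousOn cbL (Set.Icc 0 1) := cbT_cont (fun _ => 1) cb_one

lemma cbL_deriv {x : ℝ} (h0 : 0 < x) (h1 : x < 1) :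
    HasDerivAt cbL (- Real.log (1 - x) / x) x := by
  have hx : |x| < 1 := by rw [abs_of_pos h0]; exact h1
  have h := cbT_hasDerivAt _ cb_inv hx
  have e := cbT_eq (fun _ => 1) x
  rw [cb_log hx] at e
  refine h.congr_deriv ?_
  rw [e]; field_simp

lemma cbL_one : cbL 1 = Real.pi ^ 2 / 6 := by
  have h := hasSum_zeta_two
  have h2 := (hasSum_nat_add_iff' (f := fun n : ℕ => (1 : ℝ) / (n : ℝ) ^ 2) 1).2 h
  simp at h2
  rw [← h2.tsum_eq, cbL, cbT]
  congr 1; ext n; simp only [one_pow, mul_one]; field_simp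

lemma cbL_half : cbL (1 / 2) = Real.pi ^ 2 / 12 - Real.log 2 ^ 2 / 2 := by
  have key := cb_const (b := 1 / 2)
    (f := fun t => cbL t + cbL (1 - t) + Real.log t * Real.log (1 - t)) (by norm_num) ?_ ?_
  · have h0 : cbL 0 = 0 := cbT_zero _
    have e : (1 : ℝ) - 1 / 2 = 1 / 2 := by norm_num
    simp only [e, sub_zero, h0, cbL_one, Real.log_zero] at key
    have : Real.log (1 / 2) = - Real.log 2 := by rw [one_div, Real.log_inv]
    rw [this] at key
    linarith
  · refine ContinuousOn.add (ContinuousOn.add ?_ ?_) ?_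
    · exact cbL_cont.mono (Set.Icc_subset_Icc le_rfl (by norm_num))
    · refine cbL_cont.comp (by fun_prop) ?_
      intro t ht
      exact ⟨by linarith [ht.2], by linarith [ht.1]⟩
    · have : ContinuousOn (fun t : ℝ => - ((t * Real.log t) * cbS (fun n => 1 / (n + 1)) t))
          (Set.Icc 0 (1 / 2)) :=
        (Real.continuous_mul_log.continuousOn.mul (cbS_cont_half _ cb_inv)).neg
      refine this.congr ?_
      intro t ht
      have hx : |t| < 1 := by rw [abs_of_nonneg ht.1]; linarith [ht.2]
      have e := cbT_eq (fun _ => 1) t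
      rw [cb_log hx] at e
      have e2 : Real.log (1 - t) = - (t * cbS (fun n => 1 / (n + 1)) t) := by linarith
      simp only [e2]
      ring
  · intro t ht
    have h1 := cbL_deriv ht.1 (by linarith [ht.2] : t < 1)
    have h2 := cbL_deriv (x := 1 - t) (by linarith [ht.2]) (by linarith [ht.1])
    have hs : HasDerivAt (fun t : ℝ => 1 - t) (-1) t := by
      simpa using (hasDerivAt_id t).const_sub 1
    have h3 := h2.comp t hs
    have ht0 : t ≠ 0 := ht.1.ne'
    have ht1 : 1 - t ≠ 0 := by linarith [ht.2]
    have h4 := (Real.hasDerivAt_log ht0).mul (hs.log ht1)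
    refine ((h1.add h3).add h4).congr_deriv ?_
    rw [sub_sub_cancel]
    field_simp
    ring

/-! The main sum -/

lemma cbA_pos (n : ℕ) : 0 < cbA n := by
  have : 0 < (2 * n).choose n := Nat.choose_pos (by omega)
  unfold cbA
  positivity

lemma cbA_rec (n : ℕ) : cbA n / (n + 1) = 2 * (cbA n - cbA (n + 1)) := by
  have h := Nat.succ_mul_centralBinom_succ n
  simp only [Nat.centralBinom] at h
  have h' : ((n : ℝ) + 1) * ((2 * (n + 1)).choose (n + 1) : ℝ)
      = 2 * (2 * n + 1) * ((2 * n).choose n : ℝ) := by exact_mod_cast h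
  unfold cbA
  have : (n : ℝ) + 1 ≠ 0 := by positivity
  rw [pow_succ]
  field_simp
  linear_combination 2 * h'

lemma cbA_le (n : ℕ) : |cbA n| ≤ 1 := by
  rw [abs_of_pos (cbA_pos n)]
  induction n with
  | zero => simp [cbA]
  | succ n ih =>
    have := cbA_rec n
    have h2 : 0 < cbA n / (n + 1) := div_pos (cbA_pos n) (by positivity)
    linarith

lemma cb_ode {x : ℝ} (hx : |x| < 1) : 2 - cbT cbA x = 2 * (1 - x) * cbS cbA x := by
  have hs := cbS_summable cbA cbA_le hx
  have hs1 := (summable_nat_add_iff 1).2 hs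
  have e : cbS cbA x = 1 + ∑' n : ℕ, cbA (n + 1) * x ^ (n + 1) := by
    rw [cbS, hs.tsum_eq_zero_add]
    simp [cbA]
  have e2 : cbT cbA x = 2 * x * cbS cbA x - 2 * ∑' n : ℕ, cbA (n + 1) * x ^ (n + 1) := by
    rw [cbT, cbS, ← tsum_mul_left, ← tsum_mul_left, ← (hs.mul_left _).tsum_sub (hs1.mul_left _)]
    congr 1; ext n
    rw [cbA_rec]; ring
  rw [e2]
  linear_combination (-2) * e

lemma cb_x {t : ℝ} (h0 : 0 ≤ t) (h1 : t < 1 / 2) : |4 * t * (1 - t)| < 1 := by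
  rw [abs_of_nonneg (mul_nonneg (by linarith) (by linarith))]
  nlinarith [mul_pos (sub_pos.2 h1) (sub_pos.2 h1)]

lemma cb_dx (t : ℝ) : HasDerivAt (fun t : ℝ => 4 * t * (1 - t)) (4 * (1 - 2 * t)) t := by
  have := ((hasDerivAt_id t).const_mul 4).mul ((hasDerivAt_id t).const_sub 1)
  refine this.congr_deriv ?_
  simp only [id]; ring

lemma cb_comp (c : ℕ → ℝ) (hc : ∀ n, |c n| ≤ 1) {t : ℝ} (h0 : 0 ≤ t) (h1 : t < 1 / 2) :
    HasDerivAt (fun t => cbT c (4 * t * (1 - t)))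
      (cbS c (4 * t * (1 - t)) * (4 * (1 - 2 * t))) t :=
  HasDerivAt.comp (h := fun t : ℝ => 4 * t * (1 - t)) t (cbT_hasDerivAt c hc (cb_x h0 h1)) (cb_dx t)

lemma cb_G1 {b : ℝ} (h0 : 0 < b) (h1 : b < 1 / 2) : cbT cbA (4 * b * (1 - b)) = 4 * b := by
  have hd : ∀ t ∈ Set.Icc 0 b, HasDerivAt
      (fun t => (2 - cbT cbA (4 * t * (1 - t))) / (1 - 2 * t)) 0 t := by
    intro t ht
    have h1' : t < 1 / 2 := by linarith [ht.2]
    have hn : 1 - 2 * t ≠ 0 := by linarith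
    have d := (cb_comp cbA cbA_le ht.1 h1').const_sub 2
    have d2 : HasDerivAt (fun t : ℝ => 1 - 2 * t) (-2) t := by
      simpa using ((hasDerivAt_id t).const_mul 2).const_sub 1
    refine (d.div d2 hn).congr_deriv ?_
    rw [cb_ode (cb_x ht.1 h1')]
    field_simp
    ring
  have key := cb_const h0 (fun t ht => (hd t ht).continuousAt.continuousWithinAt)
    (fun t ht => hd t ⟨ht.1.le, ht.2.le⟩)
  have hn : 1 - 2 * b ≠ 0 := by linarith
  simp only [mul_zero, zero_mul, cbT_zero, sub_zero, div_one] at key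
  rw [div_eq_iff hn] at key
  linarith

lemma cb_dlog {t : ℝ} (h : t < 1) : HasDerivAt (fun t : ℝ => Real.log (1 - t)) (-1 / (1 - t)) t := by
  have hs : HasDerivAt (fun t : ℝ => 1 - t) (-1) t := by
    simpa using (hasDerivAt_id t).const_sub 1
  exact hs.log (by linarith)

lemma cb_G2 {b : ℝ} (h0 : 0 < b) (h1 : b < 1 / 2) :
    cbT (fun n => cbA n / (n + 1)) (4 * b * (1 - b)) = 8 * b + 4 * Real.log (1 - b) := by
  have hA := cb_bound cbA cbA_le
  have hd : ∀ t ∈ Set.Icc 0 b, HasDerivAt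
      (fun t => cbT (fun n => cbA n / (n + 1)) (4 * t * (1 - t)) - (8 * t + 4 * Real.log (1 - t)))
      (cbS (fun n => cbA n / (n + 1)) (4 * t * (1 - t)) * (4 * (1 - 2 * t))
        - (8 * 1 + 4 * (-1 / (1 - t)))) t := by
    intro t ht
    have h1' : t < 1 / 2 := by linarith [ht.2]
    exact (cb_comp _ hA ht.1 h1').sub
      (((hasDerivAt_id t).const_mul 8).add ((cb_dlog (by linarith)).const_mul 4))
  have key := cb_const h0 (fun t ht => (hd t ht).continuousAt.continuousWithinAt) ?_
  · simp only [mul_zero, zero_mul, cbT_zero, sub_zero, Real.log_one, add_zero] at key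
    linarith
  · intro t ht
    refine (hd t ⟨ht.1.le, ht.2.le⟩).congr_deriv ?_
    have h1' : t < 1 / 2 := by linarith [ht.2]
    have e := cbT_eq cbA (4 * t * (1 - t))
    rw [cb_G1 ht.1 h1'] at e
    have ht0 : t ≠ 0 := ht.1.ne'
    have hn : 1 - t ≠ 0 := by linarith
    have e2 : cbS (fun n => cbA n / (n + 1)) (4 * t * (1 - t)) = 1 / (1 - t) := by
      rw [eq_div_iff hn]
      apply mul_left_cancel₀ (mul_ne_zero four_ne_zero ht0)
      linear_combination -e
    rw [e2]
    field_simp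
    ring

lemma cb_G3 : cbT (fun n => cbA n / (n + 1) / (n + 1)) 1
    = 8 - 8 * Real.log 2 - 4 * cbL (1 / 2) + 2 * Real.log 2 ^ 2 := by
  have hA := cb_bound cbA cbA_le
  have hA2 := cb_bound _ hA
  have key := cb_const (b := 1 / 2) (f := fun t =>
    cbT (fun n => cbA n / (n + 1) / (n + 1)) (4 * t * (1 - t)) -
      (16 * t + 8 * Real.log (1 - t) - 4 * cbL t + 2 * Real.log (1 - t) ^ 2)) (by norm_num) ?_ ?_
  · have h0 : cbL 0 = 0 := cbT_zero _
    have e : (1 : ℝ) - 1 / 2 = 1 / 2 := by norm_num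
    have e4 : (4 : ℝ) * (1 / 2) * (1 / 2) = 1 := by norm_num
    have el : Real.log (1 / 2) = - Real.log 2 := by rw [one_div, Real.log_inv]
    simp only [e, e4, el, h0, mul_zero, zero_mul, cbT_zero, sub_zero, Real.log_one] at key
    linarith
  · have hl : ContinuousOn (fun t : ℝ => Real.log (1 - t)) (Set.Icc 0 (1 / 2)) := fun t ht =>
      (cb_dlog (by linarith [ht.2])).continuousAt.continuousWithinAt
    have hL : ContinuousOn cbL (Set.Icc 0 (1 / 2)) :=
      cbL_cont.mono (Set.Icc_subset_Icc le_rfl (by norm_num))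
    have hT : ContinuousOn (fun t : ℝ => cbT (fun n => cbA n / (n + 1) / (n + 1)) (4 * t * (1 - t)))
        (Set.Icc 0 (1 / 2)) := by
      refine (cbT_cont _ hA).comp (f := fun t : ℝ => 4 * t * (1 - t)) (by fun_prop) ?_
      intro t ht
      refine ⟨mul_nonneg (by linarith [ht.1]) (by linarith [ht.2]), ?_⟩
      nlinarith [sq_nonneg (1 - 2 * t)]
    fun_prop
  · intro t ht
    have h1' : t < 1 / 2 := ht.2
    have hl := cb_dlog (by linarith : t < 1)
    have d := (cb_comp _ hA2 ht.1.le h1').sub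
      (((((hasDerivAt_id t).const_mul 16).add (hl.const_mul 8)).sub
        ((cbL_deriv ht.1 (by linarith)).const_mul 4)).add ((hl.pow 2).const_mul 2))
    refine d.congr_deriv ?_
    have e := cbT_eq (fun n => cbA n / (n + 1)) (4 * t * (1 - t))
    rw [cb_G2 ht.1 h1'] at e
    have ht0 : t ≠ 0 := ht.1.ne'
    have hn : 1 - t ≠ 0 := by linarith
    have e2 : cbS (fun n => cbA n / (n + 1) / (n + 1)) (4 * t * (1 - t))
        = (8 * t + 4 * Real.log (1 - t)) / (4 * t * (1 - t)) := by
      rw [eq_div_iff (by positivity)]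
      linear_combination -e
    rw [e2]
    field_simp
    ring

theorem sum_central_binom_div_succ_cube :
    ∑' n : ℕ, ((2 * n).choose n : ℝ) / ((n + 1) ^ 3 * 4 ^ n)
      = 8 - 8 * Real.log 2 - Real.pi ^ 2 / 3 + 4 * Real.log 2 ^ 2 := by
  have h : ∑' n : ℕ, ((2 * n).choose n : ℝ) / ((n + 1) ^ 3 * 4 ^ n)
      = cbT (fun n => cbA n / (n + 1) / (n + 1)) 1 := by
    rw [cbT]
    congr 1; ext n
    unfold cbA
    have : (n : ℝ) + 1 ≠ 0 := by positivity
    field_simp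
    simp
  rw [h, cb_G3, cbL_half]
  ring
end
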